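/- arXiv:2311.07140 — 6 statements merged into one kernel-verified Lean document; each statement's English description precedes it below -/
import Mathlib

section
/- Let Q ∈ ℝ^{ny×ny} and R ∈ ℝ^{nu×nu} be symmetric positive definite, let c₁, c₂ > 0, and let x : ℕ → ℝ^{nx}, u : ℕ → ℝ^{nu}, y : ℕ → ℝ^{ny}, J : ℕ → ℝ, W : ℕ → ℝ be sequences satisfying, for all k ∈ ℕ: J(k+1) − J(k) ≤ −(y_kᵀ Q y_k + u_kᵀ R u_k) and W(k+1) − W(k) ≤ −(1/2)‖x_k‖² + c₁‖u_k‖² + c₂‖y_k‖². Define γ = min(λ_min(Q), λ_min(R)) / max(c₁, c₂) and V(k) = J(k) + γ W(k). Then for all k ∈ ℕ: V(k+1) − V(k) ≤ −(γ/2)‖x_k‖². -/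
open Matrix

noncomputable section

/-- Composite Lyapunov decrease argument used in the proof of Theorem 1:
combining the optimal-cost decrease of the predictive controller with the
IOSS Lyapunov inequality.  Here `lQ` and `lR` are the smallest eigenvalues of
the symmetric positive definite matrices `Q` and `R`, characterized by the
quadratic lower bound `zᵀ M z ≥ λ_min(M) ‖z‖²` (and positivity). -/
theorem composite_lyapunov_decrease
    (nx nu ny : ℕ)
    (Q : Matrix (Fin ny) (Fin ny) ℝ) (R : Matrix (Fin nu) (Fin nu) ℝ)
    (hQ : Q.PosDef) (hR : R.PosDef)
    (lQ lR : ℝ) (hlQ0 : 0 < lQ) (hlR0 : 0 < lR)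
    (hlQ : ∀ z : EuclideanSpace ℝ (Fin ny), lQ * ‖z‖^2 ≤ z ⬝ᵥ Q.mulVec z)
    (hlR : ∀ z : EuclideanSpace ℝ (Fin nu), lR * ‖z‖^2 ≤ z ⬝ᵥ R.mulVec z)
    (c₁ c₂ : ℝ) (hc₁ : 0 < c₁) (hc₂ : 0 < c₂)
    (x : ℕ → EuclideanSpace ℝ (Fin nx))
    (u : ℕ → EuclideanSpace ℝ (Fin nu))
    (y : ℕ → EuclideanSpace ℝ (Fin ny))
    (J W : ℕ → ℝ)
    (hJ : ∀ k : ℕ, J (k+1) - J k ≤ -(y k ⬝ᵥ Q.mulVec (y k) + u k ⬝ᵥ R.mulVec (u k)))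
    (hW : ∀ k : ℕ, W (k+1) - W k ≤ -(1/2) * ‖x k‖^2 + c₁ * ‖u k‖^2 + c₂ * ‖y k‖^2) :
    ∀ k : ℕ,
      (J (k+1) + (min lQ lR / max c₁ c₂) * W (k+1))
        - (J k + (min lQ lR / max c₁ c₂) * W k)
      ≤ -((min lQ lR / max c₁ c₂) / 2) * ‖x k‖^2 := by
  intro k
  have hM : 0 < max c₁ c₂ := lt_max_of_lt_left hc₁
  have hm : 0 < min lQ lR := lt_min hlQ0 hlR0
  have hg : 0 < min lQ lR / max c₁ c₂ := div_pos hm hM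
  have hgM : min lQ lR / max c₁ c₂ * max c₁ c₂ = min lQ lR := div_mul_cancel₀ _ hM.ne'
  have h1 : min lQ lR / max c₁ c₂ * c₁ ≤ lR :=
    (mul_le_mul_of_nonneg_left (le_max_left c₁ c₂) hg.le).trans (hgM.le.trans (min_le_right _ _))
  have h2 : min lQ lR / max c₁ c₂ * c₂ ≤ lQ :=
    (mul_le_mul_of_nonneg_left (le_max_right c₁ c₂) hg.le).trans (hgM.le.trans (min_le_left _ _))
  have h3 := mul_le_mul_of_nonneg_right h1 (sq_nonneg ‖u k‖)
  have h4 := mul_le_mul_of_nonneg_right h2 (sq_nonneg ‖y k‖)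
  have h5 := mul_le_mul_of_nonneg_left (hW k) hg.le
  have h6 := hJ k
  have h7 := hlQ (y k)
  have h8 := hlR (u k)
  generalize min lQ lR / max c₁ c₂ = g at *
  linarith
end
end

section
/- Let A(p) = A₀ + Σ_{i=1}^{np} p_i A_i (nx×nx) and B(p) = B₀ + Σ_{i=1}^{np} p_i B_i (nx×nu) be affine matrix functions, and let (ŭ_j, p̆_j, x̆_j)_{j=1}^{Nd} be a data trajectory satisfying x̆_{j+1} = A(p̆_j) x̆_j + B(p̆_j) ŭ_j for all 1 ≤ j ≤ Nd−1. Let Nc ≥ 1, let p̂_0, …, p̂_{Nc−1} ∈ ℝ^{np}, and let g ∈ ℝ^{Nd−Nc} satisfy the consistency equations H_Nc(x̆_{[1,Nd−1]}^{p̆}) g = 𝒫̂^{nx} H_Nc(x̆_{[1,Nd−1]}) g and H_Nc(ŭ_{[1,Nd−1]}^{p̆}) g = 𝒫̂^{nu} H_Nc(ŭ_{[1,Nd−1]}) g, where 𝒫̂^{n} = blkdiag(p̂_0 ⊗ I_n, …, p̂_{Nc−1} ⊗ I_n). Define x̂_i ∈ ℝ^{nx} for 0 ≤ i ≤ Nc−1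 as the i-th block of H_Nc(x̆_{[1,Nd−1]}) g, define x̂_Nc as the last block of H_Nc(x̆_{[2,Nd]}) g, and û_i as the i-th block of H_Nc(ŭ_{[1,Nd−1]}) g. Then x̂_{i+1} = A(p̂_i) x̂_i + B(p̂_i) û_i for all 0 ≤ i ≤ Nc−1; i.e., the sequence (û, p̂, x̂) generated through g is a trajectory of the LPV system. -/
open Matrix

noncomputable section

/-- Evaluation of an affine matrix function `p ↦ M₀ + ∑ i, p i • M i`. -/
def affEval {np n m : ℕ} (M0 : Matrix (Fin n) (Fin m) ℝ)
    (Mi : Fin np → Matrix (Fin n) (Fin m) ℝ) (p : Fin np → ℝ) :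
    Matrix (Fin n) (Fin m) ℝ :=
  M0 + ∑ i, p i • Mi i

/-- Depth-`L` block Hankel matrix of a (0-indexed) sequence `w` of vectors,
with `M` columns: the `((i,a), j)` entry is `w (i+j) a`. -/
def hankel {ι : Type} (L M : ℕ) (w : ℕ → ι → ℝ) : Matrix (Fin L × ι) (Fin M) ℝ :=
  fun q j => w (q.1.val + j.val) q.2

/-- Pointwise Kronecker-weighted sequence `{p_k ⊗ w_k}`. -/
def kronSeq {np : ℕ} {ι : Type} (p : ℕ → Fin np → ℝ) (w : ℕ → ι → ℝ) :
    ℕ → (Fin np × ι) → ℝ :=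
  fun k q => p k q.1 * w k q.2

/-- The block-diagonal scheduling matrix `𝒫 = blkdiag (p_0 ⊗ I, …, p_{L-1} ⊗ I)`. -/
def schedMat {ι : Type} [DecidableEq ι] (L np : ℕ) (p : ℕ → Fin np → ℝ) :
    Matrix (Fin L × Fin np × ι) (Fin L × ι) ℝ :=
  fun q r => if q.1 = r.1 ∧ q.2.2 = r.2 then p q.1.val q.2.1 else 0

theorem aux_cons {np n m L M : ℕ} (M0 : Matrix (Fin n) (Fin m) ℝ)
    (Mi : Fin np → Matrix (Fin n) (Fin m) ℝ) (pd ph : ℕ → Fin np → ℝ) (w : ℕ → Fin m → ℝ)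
    (g : Fin M → ℝ)
    (h : (hankel L M (kronSeq pd w)).mulVec g
        = (schedMat L np ph).mulVec ((hankel L M w).mulVec g)) (i : Fin L) (a : Fin n) :
    ∑ j : Fin M, ((affEval M0 Mi (pd (i.val + j.val))).mulVec (w (i.val + j.val))) a * g j
      = ((affEval M0 Mi (ph i.val)).mulVec (fun b => ((hankel L M w).mulVec g) (i, b))) a := by
  have key : ∀ k b, ∑ j : Fin M, pd (i.val + j.val) k * w (i.val + j.val) b * g j
      = ph i.val k * ∑ j : Fin M, w (i.val + j.val) b * g j := by
    intro k b
    have h1 := congrFun h (i, k, b)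
    have h2 : ((schedMat L np ph).mulVec ((hankel L M w).mulVec g)) (i, k, b)
        = ph i.val k * ((hankel L M w).mulVec g) (i, b) := by
      rw [Matrix.mulVec, dotProduct, Finset.sum_eq_single (i, b)]
      · simp [schedMat]
      · rintro ⟨i', b'⟩ _ hne
        have : ¬ (i = i' ∧ b = b') := by
          rintro ⟨rfl, rfl⟩
          exact hne rfl
        simp [schedMat, this]
      · simp
    rw [h2] at h1
    exact h1
  have expand : ∀ (p : Fin np → ℝ) (v : Fin m → ℝ), ((affEval M0 Mi p).mulVec v) a
      = ∑ b, (M0 a b * v b + ∑ k, Mi k a b * (p k * v b)) := by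
    intro p v
    simp only [affEval, Matrix.mulVec, dotProduct, Matrix.add_apply, Matrix.sum_apply,
      Matrix.smul_apply, smul_eq_mul, add_mul, Finset.sum_mul]
    refine Finset.sum_congr rfl fun b _ => ?_
    congr 1
    exact Finset.sum_congr rfl fun k _ => by ring
  simp only [expand]
  have hh : ∀ b, ((hankel L M w).mulVec g) (i, b) = ∑ j : Fin M, w (i.val + j.val) b * g j :=
    fun b => rfl
  simp only [hh, ← key]
  simp only [Finset.sum_mul, add_mul, Finset.mul_sum]
  rw [Finset.sum_comm]
  refine Finset.sum_congr rfl fun b _ => ?_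
  rw [Finset.sum_add_distrib]
  congr 1
  · exact Finset.sum_congr rfl fun j _ => by ring
  · rw [Finset.sum_comm]
    exact Finset.sum_congr rfl fun k _ => Finset.sum_congr rfl fun j _ => by ring

/-- The "image" direction of the data-driven state predictor (eq. (12)):
any `g` satisfying the Kronecker consistency equations generates, through the
Hankel matrices of the data, a genuine trajectory of the LPV system. -/
theorem data_driven_predictor_generates_trajectory
    (np nx nu Nd Nc : ℕ) (hNc : 1 ≤ Nc)
    (A0 : Matrix (Fin nx) (Fin nx) ℝ) (Ai : Fin np → Matrix (Fin nx) (Fin nx) ℝ)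
    (B0 : Matrix (Fin nx) (Fin nu) ℝ) (Bi : Fin np → Matrix (Fin nx) (Fin nu) ℝ)
    (ud : ℕ → Fin nu → ℝ) (pd : ℕ → Fin np → ℝ) (xd : ℕ → Fin nx → ℝ)
    (hdata : ∀ j : ℕ, j + 1 < Nd →
      xd (j+1) = (affEval A0 Ai (pd j)).mulVec (xd j) + (affEval B0 Bi (pd j)).mulVec (ud j))
    (ph : ℕ → Fin np → ℝ)
    (g : Fin (Nd - Nc) → ℝ)
    (hconsx : (hankel Nc (Nd - Nc) (kronSeq pd xd)).mulVec g
        = (schedMat Nc np ph).mulVec ((hankel Nc (Nd - Nc) xd).mulVec g))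
    (hconsu : (hankel Nc (Nd - Nc) (kronSeq pd ud)).mulVec g
        = (schedMat Nc np ph).mulVec ((hankel Nc (Nd - Nc) ud).mulVec g))
    (xh : ℕ → Fin nx → ℝ) (uh : ℕ → Fin nu → ℝ)
    (hxh : ∀ i : Fin Nc, xh i.val = fun a => ((hankel Nc (Nd - Nc) xd).mulVec g) (i, a))
    (hxhN : xh Nc = fun a =>
      ((hankel Nc (Nd - Nc) (fun k => xd (k+1))).mulVec g) (⟨Nc - 1, by omega⟩, a))
    (huh : ∀ i : Fin Nc, uh i.val = fun a => ((hankel Nc (Nd - Nc) ud).mulVec g) (i, a)) :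
    ∀ i : ℕ, i < Nc →
      xh (i+1) = (affEval A0 Ai (ph i)).mulVec (xh i) + (affEval B0 Bi (ph i)).mulVec (uh i) := by
  intro i hi
  have hx1 : xh (i+1) = fun a => ∑ j : Fin (Nd - Nc), xd (i + j.val + 1) a * g j := by
    by_cases h : i + 1 < Nc
    · rw [hxh ⟨i+1, h⟩]
      funext a
      simp only [hankel, Matrix.mulVec, dotProduct]
      refine Finset.sum_congr rfl fun j _ => ?_
      rw [show i + 1 + j.val = i + j.val + 1 by omega]
    · obtain rfl : Nc = i + 1 := by omega
      rw [hxhN]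
      rfl
  funext a
  rw [hx1, hxh ⟨i, hi⟩, huh ⟨i, hi⟩, Pi.add_apply,
    ← aux_cons A0 Ai pd ph xd g hconsx ⟨i, hi⟩ a, ← aux_cons B0 Bi pd ph ud g hconsu ⟨i, hi⟩ a,
    ← Finset.sum_add_distrib]
  refine Finset.sum_congr rfl fun j _ => ?_
  have := j.isLt
  rw [hdata (i + j.val) (by omega), Pi.add_apply, add_mul]
end
end

section
/- Let A(p) = A₀ + Σ_{i=1}^{np} p_i A_i and B(p) = B₀ + Σ_{i=1}^{np} p_i B_i be affine matrix functions (sizes nx×nx and nx×nu), and let (ŭ_j, p̆_j, x̆_j)_{j=1}^{Nd} satisfy x̆_{j+1} = A(p̆_j) x̆_j + B(p̆_j) ŭ_j for all 1 ≤ j ≤ Nd−1. Let G be the ((1+np)(nx+nu)) × (Nd−1) matrix obtained by vertically stacking H₁(x̆_{[1,Nd−1]}), H₁(x̆_{[1,Nd−1]}^{p̆}), H₁(ŭ_{[1,Nd−1]}), H₁(ŭ_{[1,Nd−1]}^{p̆}), and suppose G has full row rank, i.e., there exists M ∈ ℝ^{(Nd−1)×(1+np)(nx+nu)} with G·M = I.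 Then for every such right inverse M and all x ∈ ℝ^{nx}, u ∈ ℝ^{nu}, p ∈ ℝ^{np}: H₁(x̆_{[2,Nd]}) · M · [x; p⊗x; u; p⊗u] = A(p) x + B(p) u. In particular, the one-step state transition of the LPV system is exactly reproduced from the data. -/
open Matrix

noncomputable section

/-- `H₁(w)`: the matrix whose `j`-th column is `w j` (0-indexed, `M` columns). -/
def h1 {ι : Type} (M : ℕ) (w : ℕ → ι → ℝ) : Matrix ι (Fin M) ℝ :=
  fun a j => w j.val a

lemma aff_mulVec_aux {np n m : ℕ} (M0 : Matrix (Fin n) (Fin m) ℝ)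
    (Mi : Fin np → Matrix (Fin n) (Fin m) ℝ) (p : Fin np → ℝ) (x : Fin m → ℝ) (a : Fin n) :
    (affEval M0 Mi p).mulVec x a
      = ∑ b, M0 a b * x b + ∑ q : Fin np × Fin m, Mi q.1 a q.2 * (p q.1 * x q.2) := by
  simp only [affEval, Matrix.mulVec, dotProduct, Matrix.add_apply, Matrix.sum_apply,
    Matrix.smul_apply, smul_eq_mul, add_mul, Finset.sum_add_distrib, Finset.sum_mul]
  rw [Fintype.sum_prod_type, Finset.sum_comm]
  congr 1
  refine Finset.sum_congr rfl fun i _ => Finset.sum_congr rfl fun j _ => ?_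
  ring

/-- The stacked coefficient matrix. -/
def thetaAux {np nx nu : ℕ}
    (A0 : Matrix (Fin nx) (Fin nx) ℝ) (Ai : Fin np → Matrix (Fin nx) (Fin nx) ℝ)
    (B0 : Matrix (Fin nx) (Fin nu) ℝ) (Bi : Fin np → Matrix (Fin nx) (Fin nu) ℝ) :
    Matrix (Fin nx) (Fin nx ⊕ ((Fin np × Fin nx) ⊕ (Fin nu ⊕ Fin np × Fin nu))) ℝ :=
  fun a => Sum.elim (A0 a) (Sum.elim (fun q => Ai q.1 a q.2)
    (Sum.elim (B0 a) (fun q => Bi q.1 a q.2)))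

lemma thetaAux_mulVec {np nx nu : ℕ}
    (A0 : Matrix (Fin nx) (Fin nx) ℝ) (Ai : Fin np → Matrix (Fin nx) (Fin nx) ℝ)
    (B0 : Matrix (Fin nx) (Fin nu) ℝ) (Bi : Fin np → Matrix (Fin nx) (Fin nu) ℝ)
    (x : Fin nx → ℝ) (u : Fin nu → ℝ) (p : Fin np → ℝ) :
    (thetaAux A0 Ai B0 Bi).mulVec (Sum.elim x (Sum.elim (fun q => p q.1 * x q.2)
            (Sum.elim u (fun q => p q.1 * u q.2))))
        = (affEval A0 Ai p).mulVec x + (affEval B0 Bi p).mulVec u := by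
  funext a
  rw [Pi.add_apply, aff_mulVec_aux, aff_mulVec_aux]
  simp only [thetaAux, Matrix.mulVec, dotProduct, Fintype.sum_sum_type, Sum.elim_inl,
    Sum.elim_inr]
  ring

/-- Open-loop data-driven representation (eqs. (35)–(36)): under the
persistency-of-excitation rank condition (existence of a right inverse `M` of
the stacked data matrix `G`), the one-step state transition of the LPV system
is exactly reproduced from the data. -/
theorem open_loop_data_driven_representation
    (np nx nu Nd : ℕ)
    (A0 : Matrix (Fin nx) (Fin nx) ℝ) (Ai : Fin np → Matrix (Fin nx) (Fin nx) ℝ)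
    (B0 : Matrix (Fin nx) (Fin nu) ℝ) (Bi : Fin np → Matrix (Fin nx) (Fin nu) ℝ)
    (ud : ℕ → Fin nu → ℝ) (pd : ℕ → Fin np → ℝ) (xd : ℕ → Fin nx → ℝ)
    (hdata : ∀ j : ℕ, j + 1 < Nd →
      xd (j+1) = (affEval A0 Ai (pd j)).mulVec (xd j) + (affEval B0 Bi (pd j)).mulVec (ud j))
    (G : Matrix (Fin nx ⊕ ((Fin np × Fin nx) ⊕ (Fin nu ⊕ Fin np × Fin nu))) (Fin (Nd - 1)) ℝ)
    (hG : G = Matrix.fromRows (h1 (Nd - 1) xd)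
        (Matrix.fromRows (h1 (Nd - 1) (kronSeq pd xd))
          (Matrix.fromRows (h1 (Nd - 1) ud) (h1 (Nd - 1) (kronSeq pd ud)))))
    (M : Matrix (Fin (Nd - 1)) (Fin nx ⊕ ((Fin np × Fin nx) ⊕ (Fin nu ⊕ Fin np × Fin nu))) ℝ)
    (hM : G * M = 1) :
    ∀ (x : Fin nx → ℝ) (u : Fin nu → ℝ) (p : Fin np → ℝ),
      (h1 (Nd - 1) (fun k => xd (k+1)) * M).mulVec
          (Sum.elim x (Sum.elim (fun q => p q.1 * x q.2)
            (Sum.elim u (fun q => p q.1 * u q.2))))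
        = (affEval A0 Ai p).mulVec x + (affEval B0 Bi p).mulVec u := by
  intro x u p
  have key : h1 (Nd - 1) (fun k => xd (k+1)) = thetaAux A0 Ai B0 Bi * G := by
    ext a j
    have h := hdata j.val (by have := j.isLt; omega)
    rw [← thetaAux_mulVec] at h
    have h2 := congrFun h a
    simp only [h1]
    rw [h2, hG, Matrix.mul_apply]
    simp only [Matrix.mulVec, dotProduct]
    refine Finset.sum_congr rfl fun s _ => ?_
    rcases s with s | s | s | s <;> rfl
  rw [key, Matrix.mul_assoc, hM, Matrix.mul_one, thetaAux_mulVec]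
end
end

section
/- (Closed-loop data-driven representation.) Let A(p) = A₀ + Σ_{i=1}^{np} p_i A_i, B(p) = B₀ + Σ_{i=1}^{np} p_i B_i and K(p) = K₀ + Σ_{i=1}^{np} p_i K_i be affine matrix functions (sizes nx×nx, nx×nu, nu×nx), and let (ŭ_j, p̆_j, x̆_j)_{j=1}^{Nd} satisfy x̆_{j+1} = A(p̆_j) x̆_j + B(p̆_j) ŭ_j for all 1 ≤ j ≤ Nd−1. Let G be the vertical stack of H₁(x̆_{[1,Nd−1]}), H₁(x̆_{[1,Nd−1]}^{p̆}), H₁(ŭ_{[1,Nd−1]}), H₁(ŭ_{[1,Nd−1]}^{p̆}), and let 𝒱 ∈ ℝ^{(Nd−1) × nx(1+np+np²)} be any matrix satisfying G·𝒱 = [[I_{nx}, 0, 0]; [0, I_{np}⊗I_{nx}, 0]; [K₀, K̄, 0]; [0, I_{np}⊗K₀, I_{np}⊗K̄]], where K̄ = [K₁ ⋯ K_{np}]. Then for all x ∈ ℝ^{nx} and p ∈ ℝ^{np}: H₁(x̆_{[2,Nd]}) · 𝒱 · [x; p⊗x; p⊗p⊗x] = (A(p) + B(p)K(p)) x; i.e.,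 the closed-loop system under the state-feedback law u = K(p)x is represented purely from data. -/
open Matrix

noncomputable section

/-- The block matrix `[[I,0,0];[0,I_np⊗I,0];[K₀,K̄,0];[0,I_np⊗K₀,I_np⊗K̄]]`
appearing in the consistency condition `G·𝒱 = …` of Proposition 3. -/
def clTarget (np nx nu : ℕ) (K0 : Matrix (Fin nu) (Fin nx) ℝ)
    (Ki : Fin np → Matrix (Fin nu) (Fin nx) ℝ) :
    Matrix (Fin nx ⊕ ((Fin np × Fin nx) ⊕ (Fin nu ⊕ Fin np × Fin nu)))
      (Fin nx ⊕ ((Fin np × Fin nx) ⊕ (Fin np × Fin np × Fin nx))) ℝ :=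
  fun r c =>
    match r, c with
    | .inl b, .inl c' => if b = c' then 1 else 0
    | .inl _, .inr _ => 0
    | .inr (.inl (i, b)), .inr (.inl (i', b')) => if i = i' ∧ b = b' then 1 else 0
    | .inr (.inl _), .inl _ => 0
    | .inr (.inl _), .inr (.inr _) => 0
    | .inr (.inr (.inl r')), .inl c' => K0 r' c'
    | .inr (.inr (.inl r')), .inr (.inl (i, c')) => Ki i r' c'
    | .inr (.inr (.inl _)), .inr (.inr _) => 0
    | .inr (.inr (.inr (i, r'))), .inr (.inl (i', c')) => if i = i' then K0 r' c' else 0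
    | .inr (.inr (.inr (i, r'))), .inr (.inr (i', jc)) => if i = i' then Ki jc.1 r' jc.2 else 0
    | .inr (.inr (.inr _)), .inl _ => 0

theorem aff_aux {np n m N : ℕ} (M0 : Matrix (Fin n) (Fin m) ℝ)
    (Mi : Fin np → Matrix (Fin n) (Fin m) ℝ) (pd : ℕ → Fin np → ℝ) (w : ℕ → Fin m → ℝ)
    (g : Fin N → ℝ) (y : Fin m → ℝ) (p : Fin np → ℝ)
    (h0 : ∀ b, ∑ j : Fin N, w j b * g j = y b)
    (h1 : ∀ i b, ∑ j : Fin N, pd j i * w j b * g j = p i * y b) (a : Fin n) :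
    ∑ j : Fin N, (affEval M0 Mi (pd j)).mulVec (w j) a * g j
      = (affEval M0 Mi p).mulVec y a := by
  have key : ∀ (q : Fin np → ℝ) (v : Fin m → ℝ), (affEval M0 Mi q).mulVec v a
      = ∑ b, M0 a b * v b + ∑ b, ∑ i, Mi i a b * (q i * v b) := by
    intro q v
    simp only [affEval, mulVec, dotProduct, Matrix.add_apply, Matrix.sum_apply,
      Matrix.smul_apply, smul_eq_mul, add_mul, Finset.sum_add_distrib, Finset.sum_mul]
    congr 1
    refine Finset.sum_congr rfl fun b _ => Finset.sum_congr rfl fun i _ => ?_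
    ring
  simp only [key, ← h1]
  simp only [← h0, add_mul, Finset.sum_add_distrib, Finset.sum_mul, Finset.mul_sum]
  congr 1
  · rw [Finset.sum_comm]
    refine Finset.sum_congr rfl fun b _ => Finset.sum_congr rfl fun i _ => ?_
    ring
  · rw [Finset.sum_comm]
    refine Finset.sum_congr rfl fun b _ => ?_
    rw [Finset.sum_comm]
    refine Finset.sum_congr rfl fun b _ => Finset.sum_congr rfl fun i _ => ?_
    ring

/-- Proposition 3: closed-loop data-driven representation.  Any `𝒱` solving the
data consistency equation `G·𝒱 = [[I,0,0];[0,I⊗I,0];[K₀,K̄,0];[0,I⊗K₀,I⊗K̄]]`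
represents the closed-loop map `x ↦ (A(p)+B(p)K(p))x` purely from data. -/
theorem closed_loop_data_driven_representation
    (np nx nu Nd : ℕ)
    (A0 : Matrix (Fin nx) (Fin nx) ℝ) (Ai : Fin np → Matrix (Fin nx) (Fin nx) ℝ)
    (B0 : Matrix (Fin nx) (Fin nu) ℝ) (Bi : Fin np → Matrix (Fin nx) (Fin nu) ℝ)
    (K0 : Matrix (Fin nu) (Fin nx) ℝ) (Ki : Fin np → Matrix (Fin nu) (Fin nx) ℝ)
    (ud : ℕ → Fin nu → ℝ) (pd : ℕ → Fin np → ℝ) (xd : ℕ → Fin nx → ℝ)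
    (hdata : ∀ j : ℕ, j + 1 < Nd →
      xd (j+1) = (affEval A0 Ai (pd j)).mulVec (xd j) + (affEval B0 Bi (pd j)).mulVec (ud j))
    (G : Matrix (Fin nx ⊕ ((Fin np × Fin nx) ⊕ (Fin nu ⊕ Fin np × Fin nu))) (Fin (Nd - 1)) ℝ)
    (hG : G = Matrix.fromRows (h1 (Nd - 1) xd)
        (Matrix.fromRows (h1 (Nd - 1) (kronSeq pd xd))
          (Matrix.fromRows (h1 (Nd - 1) ud) (h1 (Nd - 1) (kronSeq pd ud)))))
    (V : Matrix (Fin (Nd - 1))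
      (Fin nx ⊕ ((Fin np × Fin nx) ⊕ (Fin np × Fin np × Fin nx))) ℝ)
    (hV : G * V = clTarget np nx nu K0 Ki) :
    ∀ (x : Fin nx → ℝ) (p : Fin np → ℝ),
      (h1 (Nd - 1) (fun k => xd (k+1)) * V).mulVec
          (Sum.elim x (Sum.elim (fun q => p q.1 * x q.2)
            (fun q => p q.1 * p q.2.1 * x q.2.2)))
        = (affEval A0 Ai p + affEval B0 Bi p * affEval K0 Ki p).mulVec x := by
  intro x p
  set z : (Fin nx ⊕ ((Fin np × Fin nx) ⊕ (Fin np × Fin np × Fin nx))) → ℝ :=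
    Sum.elim x (Sum.elim (fun q => p q.1 * x q.2)
            (fun q => p q.1 * p q.2.1 * x q.2.2)) with hz
  have hg : G.mulVec (V.mulVec z) = (clTarget np nx nu K0 Ki).mulVec z := by
    rw [Matrix.mulVec_mulVec, hV]
  rw [← Matrix.mulVec_mulVec]
  generalize V.mulVec z = g at hg
  have keyK : ∀ r, (affEval K0 Ki p).mulVec x r
      = ∑ b, K0 r b * x b + ∑ i, ∑ b, Ki i r b * (p i * x b) := by
    intro r
    simp only [affEval, mulVec, dotProduct, Matrix.add_apply, Matrix.sum_apply,
      Matrix.smul_apply, smul_eq_mul, add_mul, Finset.sum_add_distrib, Finset.sum_mul]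
    congr 1
    rw [Finset.sum_comm]
    refine Finset.sum_congr rfl fun b _ => Finset.sum_congr rfl fun i _ => ?_
    ring
  have hx : ∀ b, ∑ j : Fin (Nd - 1), xd j b * g j = x b := by
    intro b
    have := congrFun hg (.inl b)
    simpa [hG, hz, mulVec, dotProduct, h1, kronSeq, clTarget] using this
  have hpx : ∀ i b, ∑ j : Fin (Nd - 1), pd j i * xd j b * g j = p i * x b := by
    intro i b
    have := congrFun hg (.inr (.inl (i, b)))
    simpa [hG, hz, mulVec, dotProduct, h1, kronSeq, clTarget, Fintype.sum_prod_type,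
      ite_and] using this
  have hu : ∀ r, ∑ j : Fin (Nd - 1), ud j r * g j = (affEval K0 Ki p).mulVec x r := by
    intro r
    rw [keyK]
    have := congrFun hg (.inr (.inr (.inl r)))
    simpa [hG, hz, mulVec, dotProduct, h1, kronSeq, clTarget, Fintype.sum_prod_type] using this
  have hpu : ∀ i r, ∑ j : Fin (Nd - 1), pd j i * ud j r * g j
      = p i * (affEval K0 Ki p).mulVec x r := by
    intro i r
    rw [keyK]
    have := congrFun hg (.inr (.inr (.inr (i, r))))
    simp [hG, hz, mulVec, dotProduct, h1, kronSeq, clTarget, Fintype.sum_prod_type] at this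
    rw [this]
    rw [mul_add, Finset.mul_sum, Finset.mul_sum]
    congr 1
    · exact Finset.sum_congr rfl fun b _ => by ring
    · refine Finset.sum_congr rfl fun k _ => ?_
      rw [Finset.mul_sum]
      exact Finset.sum_congr rfl fun b _ => by ring
  funext a
  rw [Matrix.add_mulVec, ← Matrix.mulVec_mulVec, Pi.add_apply,
    ← aff_aux A0 Ai pd xd g x p hx hpx a, ← aff_aux B0 Bi pd ud g _ p hu hpu a,
    ← Finset.sum_add_distrib]
  simp only [mulVec, dotProduct, h1]
  refine Finset.sum_congr rfl fun j _ => ?_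
  rw [hdata j (by have := j.2; omega), Pi.add_apply, add_mul]
  rfl
end
end

section
/- (Shifted candidate solution for the state-feedback predictive controller.) Let A(p), B(p) be affine matrix functions of p ∈ ℝ^{np}, let ℙ ⊆ ℝ^{np}, let 𝕌 ⊆ ℝ^{nu}, 𝕏 ⊆ ℝ^{nx}, 𝕏_f ⊆ 𝕏, let Q, R be symmetric positive definite, let ℓ(u,x) = xᵀQx + uᵀRu, let Z be symmetric positive definite with V_f(x) = xᵀZx, and let K : ℙ → ℝ^{nu×nx} satisfy: (a) for all x ∈ ℝ^{nx} and p ∈ ℙ, V_f(A(p)x + B(p)K(p)x) − V_f(x) ≤ −xᵀ(Q + K(p)ᵀRK(p))x; (b) for all x ∈ 𝕏_f and p ∈ ℙ, A(p)x + B(p)K(p)x ∈ 𝕏_f and K(p)x ∈ 𝕌. Let N ≥ 1, let p₀, …, p_N ∈ ℙ, and let x₀ ∈ ℝ^{nx} with inputs u₀, …, u_{N−1} and states x_{i+1} = A(p_i)x_i + B(p_i)u_i satisfying u_i ∈ 𝕌 and x_{i+1} ∈ 𝕏 for 0 ≤ i ≤ N−1 and x_N ∈ 𝕏_f. Define the shifted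 candidate: u'_i = u_{i+1} for 0 ≤ i ≤ N−2 and u'_{N−1} = K(p_N)x_N, starting from x'₀ = x₁ with scheduling p₁, …, p_N, producing states x'_{i+1} = A(p_{i+1})x'_i + B(p_{i+1})u'_i. Then u'_i ∈ 𝕌 and x'_{i+1} ∈ 𝕏 for all 0 ≤ i ≤ N−1, x'_N ∈ 𝕏_f, and V_f(x'_N) + Σ_{i=0}^{N−1} ℓ(u'_i, x'_i) ≤ V_f(x_N) + Σ_{i=0}^{N−1} ℓ(u_i, x_i) − ℓ(u₀, x₀). -/
open Matrix

noncomputable section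

/-- Shifted candidate solution for the state-feedback predictive controller:
recursive feasibility and the optimal-cost decrease inequality of Theorem 2. -/
theorem shifted_candidate_solution
    (np nx nu N : ℕ) (hN : 1 ≤ N)
    (A0 : Matrix (Fin nx) (Fin nx) ℝ) (Ai : Fin np → Matrix (Fin nx) (Fin nx) ℝ)
    (B0 : Matrix (Fin nx) (Fin nu) ℝ) (Bi : Fin np → Matrix (Fin nx) (Fin nu) ℝ)
    (P : Set (Fin np → ℝ)) (U : Set (Fin nu → ℝ)) (X Xf : Set (Fin nx → ℝ))
    (hXfX : Xf ⊆ X)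
    (Q : Matrix (Fin nx) (Fin nx) ℝ) (R : Matrix (Fin nu) (Fin nu) ℝ)
    (hQ : Q.PosDef) (hR : R.PosDef)
    (Z : Matrix (Fin nx) (Fin nx) ℝ) (hZ : Z.PosDef)
    (K : (Fin np → ℝ) → Matrix (Fin nu) (Fin nx) ℝ)
    -- (a) quadratic stabilizability with terminal cost V_f(x) = xᵀZx
    (hKdec : ∀ (x : Fin nx → ℝ), ∀ p ∈ P,
      ((affEval A0 Ai p).mulVec x + (affEval B0 Bi p).mulVec ((K p).mulVec x)) ⬝ᵥ
          Z.mulVec ((affEval A0 Ai p).mulVec x + (affEval B0 Bi p).mulVec ((K p).mulVec x))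
        - x ⬝ᵥ Z.mulVec x
      ≤ -(x ⬝ᵥ (Q + (K p)ᵀ * R * K p).mulVec x))
    -- (b) positive invariance of the terminal set and input admissibility
    (hKinv : ∀ x ∈ Xf, ∀ p ∈ P,
      ((affEval A0 Ai p).mulVec x + (affEval B0 Bi p).mulVec ((K p).mulVec x)) ∈ Xf ∧
        (K p).mulVec x ∈ U)
    -- the given feasible trajectory
    (p : ℕ → Fin np → ℝ) (hp : ∀ i ≤ N, p i ∈ P)
    (x : ℕ → Fin nx → ℝ) (u : ℕ → Fin nu → ℝ)
    (hdyn : ∀ i < N,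
      x (i+1) = (affEval A0 Ai (p i)).mulVec (x i) + (affEval B0 Bi (p i)).mulVec (u i))
    (hcon : ∀ i < N, u i ∈ U ∧ x (i+1) ∈ X)
    (hterm : x N ∈ Xf)
    -- the shifted candidate
    (u' : ℕ → Fin nu → ℝ) (x' : ℕ → Fin nx → ℝ)
    (hu' : ∀ i : ℕ, i + 1 < N → u' i = u (i+1))
    (hu'N : u' (N-1) = (K (p N)).mulVec (x N))
    (hx'0 : x' 0 = x 1)
    (hdyn' : ∀ i < N,
      x' (i+1) = (affEval A0 Ai (p (i+1))).mulVec (x' i)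
        + (affEval B0 Bi (p (i+1))).mulVec (u' i)) :
    (∀ i < N, u' i ∈ U ∧ x' (i+1) ∈ X) ∧ x' N ∈ Xf ∧
      (x' N ⬝ᵥ Z.mulVec (x' N)
          + ∑ i ∈ Finset.range N,
              (x' i ⬝ᵥ Q.mulVec (x' i) + u' i ⬝ᵥ R.mulVec (u' i))
        ≤ x N ⬝ᵥ Z.mulVec (x N)
          + ∑ i ∈ Finset.range N,
              (x i ⬝ᵥ Q.mulVec (x i) + u i ⬝ᵥ R.mulVec (u i))
          - (x 0 ⬝ᵥ Q.mulVec (x 0) + u 0 ⬝ᵥ R.mulVec (u 0))) := by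
  obtain ⟨M, rfl⟩ : ∃ M, N = M + 1 := ⟨N - 1, by omega⟩
  simp only [Nat.add_sub_cancel] at hu'N
  have hx : ∀ i, i < M + 1 → x' i = x (i+1) := by
    intro i
    induction i with
    | zero => intro _; exact hx'0
    | succ k ih =>
      intro hk
      rw [hdyn' k (by omega), ih (by omega), hu' k hk, ← hdyn (k+1) hk]
  have hxM := hx M (by omega)
  have hlast : x' (M+1) = (affEval A0 Ai (p (M+1))).mulVec (x (M+1))
      + (affEval B0 Bi (p (M+1))).mulVec ((K (p (M+1))).mulVec (x (M+1))) := by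
    rw [hdyn' M (by omega), hxM, hu'N]
  obtain ⟨h1, h2⟩ := hKinv _ hterm _ (hp (M+1) le_rfl)
  rw [← hlast] at h1
  refine ⟨?_, h1, ?_⟩
  · intro i hi
    rcases Nat.lt_or_ge i M with h | h
    · rw [hu' i (by omega), hx (i+1) (by omega)]
      exact hcon (i+1) (by omega)
    · obtain rfl : i = M := by omega
      exact ⟨hu'N ▸ h2, hXfX h1⟩
  · have hd := hKdec (x (M+1)) _ (hp (M+1) le_rfl)
    rw [← hlast] at hd
    have hq : x (M+1) ⬝ᵥ (Q + (K (p (M+1)))ᵀ * R * K (p (M+1))).mulVec (x (M+1))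
        = x (M+1) ⬝ᵥ Q.mulVec (x (M+1)) + u' M ⬝ᵥ R.mulVec (u' M) := by
      rw [hu'N, Matrix.add_mulVec, dotProduct_add, ← Matrix.mulVec_mulVec,
        ← Matrix.mulVec_mulVec, Matrix.dotProduct_mulVec (x (M+1)) (K (p (M+1)))ᵀ,
        Matrix.vecMul_transpose]
    rw [hq] at hd
    have hs : ∑ i ∈ Finset.range M, (x' i ⬝ᵥ Q.mulVec (x' i) + u' i ⬝ᵥ R.mulVec (u' i))
        = ∑ i ∈ Finset.range M,
          (x (i+1) ⬝ᵥ Q.mulVec (x (i+1)) + u (i+1) ⬝ᵥ R.mulVec (u (i+1))) := by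
      refine Finset.sum_congr rfl fun i hi => ?_
      have := Finset.mem_range.1 hi
      rw [hx i (by omega), hu' i (by omega)]
    rw [Finset.sum_range_succ, hs, hxM, Finset.sum_range_succ']
    linarith
end
end

section
/- (Companion state-space realization of a shifted-affine SISO LPV-IO recursion.) Let na, nb ≥ 1, n = max(na, nb), and let a_i, b_i : ℝ^{np} → ℝ be affine functions for 1 ≤ i ≤ n, with a_i = 0 for i > na and b_i = 0 for i > nb. Define the companion matrices A(p) ∈ ℝ^{n×n} with first column (a₁(p), …, a_n(p))ᵀ, identity entries on the superdiagonal positions (i, i+1) for 1 ≤ i ≤ n−1, and zeros elsewhere; B(p) = (b₁(p), …, b_n(p))ᵀ; and C = (1, 0, …, 0). Then a triple of sequences (u, p, y) : ℤ → ℝ × ℝ^{np} × ℝ satisfies the recursion y_k = Σ_{i=1}^{n} a_i(p_{k−i}) y_{k−i} + Σ_{i=1}^{n} b_i(p_{k−i}) u_{k−i} for all k ∈ ℤ if and only if there exists a state sequence x : ℤ → ℝ^{n} with x_{k+1} = A(p_k) x_k + B(p_k) u_k and y_k = C x_k for all k ∈ ℤ. -/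
open Matrix

noncomputable section

/-- Evaluation of an affine scalar function `p ↦ c₀ + ∑ j, c j * p j`. -/
def affScalar {np : ℕ} (c0 : ℝ) (c : Fin np → ℝ) (p : Fin np → ℝ) : ℝ :=
  c0 + ∑ j, c j * p j

/-- Companion matrix `A(p)`: first column `(a₁(p),…,a_n(p))ᵀ`, ones on the
superdiagonal, zeros elsewhere. -/
def companionA {np n : ℕ} (a0 : Fin n → ℝ) (aj : Fin n → Fin np → ℝ)
    (p : Fin np → ℝ) : Matrix (Fin n) (Fin n) ℝ :=
  fun r c =>
    if c.val = 0 then affScalar (a0 r) (aj r) p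
    else if c.val = r.val + 1 then 1 else 0

lemma companionA_mulVec_aux {np n : ℕ} (h0 : 0 < n) (a0 : Fin n → ℝ) (aj : Fin n → Fin np → ℝ)
    (p : Fin np → ℝ) (x : Fin n → ℝ) (r : Fin n) :
    (companionA a0 aj p).mulVec x r = affScalar (a0 r) (aj r) p * x ⟨0, h0⟩
      + (if h : r.val + 1 < n then x ⟨r.val + 1, h⟩ else 0) := by
  have key : ∀ c : Fin n, companionA a0 aj p r c * x c =
      (if c = ⟨0, h0⟩ then affScalar (a0 r) (aj r) p * x c else 0)
        + (if c.val = r.val + 1 then x c else 0) := by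
    intro c
    unfold companionA
    by_cases h : c.val = 0
    · have h2 : c = ⟨0, h0⟩ := Fin.ext h
      subst h2
      simp
    · have h2 : c ≠ ⟨0, h0⟩ := fun h' => h (by rw [h'])
      by_cases h3 : c.val = r.val + 1 <;> simp [h2, h3, h]
  simp only [Matrix.mulVec, dotProduct]
  rw [Finset.sum_congr rfl (fun c _ => key c), Finset.sum_add_distrib]
  congr 1
  · simp
  · split_ifs with h
    · rw [Finset.sum_eq_single (⟨r.val + 1, h⟩ : Fin n)]
      · simp
      · intro b _ hb
        rw [if_neg]
        intro h'
        exact hb (Fin.ext h')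
      · simp
    · apply Finset.sum_eq_zero
      intro c _
      rw [if_neg]
      have := c.isLt
      omega

/-- Remark 1 (SISO case): behavioral equivalence between the shifted-affine
LPV-IO recursion and its companion LPV state-space realization with
`C = (1,0,…,0)`. -/
theorem companion_realization_siso
    (np na nb n : ℕ) (hna : 1 ≤ na) (hnb : 1 ≤ nb) (hn : n = max na nb)
    (a0 : Fin n → ℝ) (aj : Fin n → Fin np → ℝ)
    (b0 : Fin n → ℝ) (bj : Fin n → Fin np → ℝ)
    (havanish : ∀ i : Fin n, na ≤ i.val → (a0 i = 0 ∧ ∀ j, aj i j = 0))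
    (hbvanish : ∀ i : Fin n, nb ≤ i.val → (b0 i = 0 ∧ ∀ j, bj i j = 0))
    (u : ℤ → ℝ) (p : ℤ → Fin np → ℝ) (y : ℤ → ℝ) :
    (∀ k : ℤ,
        y k = (∑ i : Fin n,
            affScalar (a0 i) (aj i) (p (k - (i.val + 1))) * y (k - (i.val + 1)))
          + ∑ i : Fin n,
            affScalar (b0 i) (bj i) (p (k - (i.val + 1))) * u (k - (i.val + 1)))
      ↔ ∃ x : ℤ → Fin n → ℝ,
          (∀ k : ℤ,
            x (k+1) = (companionA a0 aj (p k)).mulVec (x k)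
              + fun r => affScalar (b0 r) (bj r) (p k) * u k) ∧
          ∀ k : ℤ, y k = x k ⟨0, by omega⟩ := by
  have h0 : 0 < n := by omega
  set F : ℕ → ℤ → ℝ := fun i j => if h : i < n then
    affScalar (a0 ⟨i, h⟩) (aj ⟨i, h⟩) (p j) * y j
      + affScalar (b0 ⟨i, h⟩) (bj ⟨i, h⟩) (p j) * u j else 0 with hF
  have hrec : ∀ k : ℤ, (∑ i : Fin n,
            affScalar (a0 i) (aj i) (p (k - (i.val + 1))) * y (k - (i.val + 1)))
          + ∑ i : Fin n,
            affScalar (b0 i) (bj i) (p (k - (i.val + 1))) * u (k - (i.val + 1))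
        = ∑ i ∈ Finset.range n, F i (k - (i + 1)) := by
    intro k
    rw [← Finset.sum_add_distrib, ← Fin.sum_univ_eq_sum_range (fun i => F i (k - (i + 1))) n]
    apply Finset.sum_congr rfl
    intro i _
    simp [hF]
  simp only [hrec]
  constructor
  · intro hy
    refine ⟨fun k r => ∑ i ∈ Finset.range (n - r.val), F (r.val + i) (k - (i + 1)), ?_, ?_⟩
    · intro k
      funext r
      rw [Pi.add_apply, companionA_mulVec_aux h0]
      have hy0 : (∑ i ∈ Finset.range (n - 0), F (0 + i) (k - (i + 1))) = y k := by
        rw [hy k]; simp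
      have hr := r.isLt
      have hs : n - r.val = (n - (r.val + 1)) + 1 := by omega
      have hFr : F r.val k = affScalar (a0 r) (aj r) (p k) * y k
          + affScalar (b0 r) (bj r) (p k) * u k := by simp [hF]
      have h1 : (if h : r.val + 1 < n then
          ∑ i ∈ Finset.range (n - (r.val + 1)), F (r.val + 1 + i) (k - (i + 1)) else 0)
          = ∑ i ∈ Finset.range (n - (r.val + 1)), F (r.val + 1 + i) (k - (i + 1)) := by
        split_ifs with h
        · rfl
        · have : n - (r.val + 1) = 0 := by omega
          rw [this]; simp
      simp only [hy0]
      rw [h1, hs, Finset.sum_range_succ']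
      have h2 : F (r.val + 0) (k + 1 - (((0 : ℕ) : ℤ) + 1)) = F r.val k := by
        congr 1; push_cast; ring
      rw [h2, hFr]
      have h3 : ∀ i : ℕ, F (r.val + (i + 1)) (k + 1 - (((i + 1 : ℕ) : ℤ) + 1))
          = F (r.val + 1 + i) (k - (i + 1)) := by
        intro i
        congr 1
        · ring
        · push_cast; ring
      simp only [h3]
      ring
    · intro k
      rw [hy k]; simp
  · rintro ⟨x, hx, hyx⟩ k
    set X : ℤ → ℕ → ℝ := fun k r => if h : r < n then x k ⟨r, h⟩ else 0 with hX
    have hstep : ∀ (k : ℤ) (r : ℕ), r < n → X (k + 1) r = F r k + X k (r + 1) := by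
      intro k r hr
      have := congrFun (hx k) ⟨r, hr⟩
      rw [Pi.add_apply, companionA_mulVec_aux h0, ← hyx k] at this
      simp only [hX, hF, hr, dif_pos]
      rw [this]
      ring
    have hind : ∀ m : ℕ, m ≤ n → y k = ∑ i ∈ Finset.range m, F i (k - (i + 1)) + X (k - m) m := by
      intro m
      induction m with
      | zero => intro _; simp [hX, h0, hyx k]
      | succ m ih =>
        intro hm
        rw [ih (by omega), Finset.sum_range_succ]
        have := hstep (k - (m + 1)) m (by omega)
        have e : k - ((m : ℤ) + 1) + 1 = k - m := by ring
        rw [e] at this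
        rw [this]
        push_cast
        ring
    have := hind n le_rfl
    simpa [hX] using this
end
end
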